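/- Suppose ε_2 ∉ K and that at least one of the following holds: (a) K is of type C, s ≥ 1 and a ∈ −K*^{2^s}; (b) K is of type D or of type E with constant m, 1 ≤ s ≤ m − 1 and a ∈ −K*^{2^s}. Let n ≥ 1, a ∈ K*, A = K[X]/(X^{2^n} − a) with ḡ the image of X, s = H_n(a), and write a = −b^{2^s} with b ∈ K*. Set λ = −1 if K is of type E and s = m − 1, and λ = 1 in all other cases. Then all the coefficients appearing below lie in K, and the minimal idempotents of A are exactly the 2^{s−1} elements e_i = (1/2^s)·Σ_{j=0}^{2^s−1} (ε_{s+1}^{−j}·ε_{s−1}^{−ij} + λ^{j}·ε_{s+1}^{j}·ε_{s−1}^{ij})·(b^{−1}·ḡ^{2^{n−s}})^j for i = 0, 1, …, 2^{s−1} − 1. -/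

import Mathlib

noncomputable section

/-- `x ∈ K̄` lies in (the image of) the base field `K`. -/
def InK (K : Type*) [Field K] (x : AlgebraicClosure K) : Prop :=
  x ∈ Set.range (algebraMap K (AlgebraicClosure K))

/-- Type A: `ε₂ ∈ K` and `εₙ ∈ K` for every `n`. -/
def TypeA (K : Type*) [Field K] (ε : ℕ → AlgebraicClosure K) : Prop :=
  InK K (ε 2) ∧ ∀ n : ℕ, InK K (ε n)

/-- Type B: `ε₂ ∈ K` and there is a unique `m ≥ 2` with `ε_m ∈ K`, `ε_{m+1} ∉ K`. -/
def TypeB (K : Type*) [Field K] (ε : ℕ → AlgebraicClosure K) : Prop :=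
  InK K (ε 2) ∧ ∃! m : ℕ, 2 ≤ m ∧ InK K (ε m) ∧ ¬InK K (ε (m + 1))

/-- Type C: `ε₂ ∉ K` and `εₙ + εₙ⁻¹ ∈ K` for every `n`. -/
def TypeC (K : Type*) [Field K] (ε : ℕ → AlgebraicClosure K) : Prop :=
  ¬InK K (ε 2) ∧ ∀ n : ℕ, InK K (ε n + (ε n)⁻¹)

/-- Type D: `ε₂ ∉ K` and there is a unique `m ≥ 2` with `ε_m + ε_m⁻¹ ∈ K`,
`ε_{m+1} + ε_{m+1}⁻¹ ∉ K` and `ε_{m+1} - ε_{m+1}⁻¹ ∉ K`. -/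
def TypeD (K : Type*) [Field K] (ε : ℕ → AlgebraicClosure K) : Prop :=
  ¬InK K (ε 2) ∧ ∃! m : ℕ, 2 ≤ m ∧ InK K (ε m + (ε m)⁻¹) ∧
    ¬InK K (ε (m + 1) + (ε (m + 1))⁻¹) ∧ ¬InK K (ε (m + 1) - (ε (m + 1))⁻¹)

/-- Type E: `ε₂ ∉ K` and there is a unique `m ≥ 3` with `ε_m - ε_m⁻¹ ∈ K`. -/
def TypeE (K : Type*) [Field K] (ε : ℕ → AlgebraicClosure K) : Prop :=
  ¬InK K (ε 2) ∧ ∃! m : ℕ, 3 ≤ m ∧ InK K (ε m - (ε m)⁻¹)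

/-- Type B with constant `m`. -/
def TypeBc (K : Type*) [Field K] (ε : ℕ → AlgebraicClosure K) (m : ℕ) : Prop :=
  InK K (ε 2) ∧ 2 ≤ m ∧ InK K (ε m) ∧ ¬InK K (ε (m + 1))

/-- Type D with constant `m`. -/
def TypeDc (K : Type*) [Field K] (ε : ℕ → AlgebraicClosure K) (m : ℕ) : Prop :=
  ¬InK K (ε 2) ∧ 2 ≤ m ∧ InK K (ε m + (ε m)⁻¹) ∧
    ¬InK K (ε (m + 1) + (ε (m + 1))⁻¹) ∧ ¬InK K (ε (m + 1) - (ε (m + 1))⁻¹)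

/-- Type E with constant `m`. -/
def TypeEc (K : Type*) [Field K] (ε : ℕ → AlgebraicClosure K) (m : ℕ) : Prop :=
  ¬InK K (ε 2) ∧ 3 ≤ m ∧ InK K (ε m - (ε m)⁻¹)

/-- `a ∈ K_s = K* ∩ (K(ε₂)*)^{2^s}`: `a = α^{2^s}` for some `α ∈ K(ε₂)*`. -/
def MemKs (K : Type*) [Field K] (ε : ℕ → AlgebraicClosure K) (s : ℕ) (a : K) : Prop :=
  ∃ α : AlgebraicClosure K, α ∈ IntermediateField.adjoin K {ε 2} ∧ α ≠ 0 ∧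
    algebraMap K (AlgebraicClosure K) a = α ^ 2 ^ s

/-- A minimal idempotent of a commutative ring: a nonzero idempotent which is not
the sum of two nonzero orthogonal idempotents. -/
def IsMinIdem {A : Type*} [CommRing A] (e : A) : Prop :=
  e ≠ 0 ∧ e * e = e ∧
    ¬∃ e₁ e₂ : A, e₁ ≠ 0 ∧ e₂ ≠ 0 ∧ e₁ * e₁ = e₁ ∧ e₂ * e₂ = e₂ ∧
      e₁ * e₂ = 0 ∧ e = e₁ + e₂

open Polynomial in
/-- If `-1` is a square and `c` is not a square (or `k = 0`), then `X ^ 2 ^ k - c` is irreducible. -/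
theorem irreducible_X_pow_two_pow_sub_C.{u} (k : ℕ) :
    ∀ {L : Type u} [Field L] {i c : L}, i ^ 2 = -1 → (k ≠ 0 → ∀ d : L, d ^ 2 ≠ c) →
      Irreducible (X ^ 2 ^ k - C c) := by
  induction k with
  | zero =>
    intro L _ i c _ _
    simpa using irreducible_X_sub_C c
  | succ k ih =>
    intro L _ i c hi hc
    have hirr : Irreducible (X ^ 2 - C c) :=
      X_pow_sub_C_irreducible_of_prime Nat.prime_two (hc k.succ_ne_zero)
    rw [pow_succ]
    refine X_pow_mul_sub_C_irreducible hirr fun E _ _ x hx => ?_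
    have hint : IsIntegral L x := not_not.mp fun h => by
      apply (monic_X_pow_sub_C c two_ne_zero).ne_zero
      rw [← hx, minpoly.eq_zero h]
    refine ih (i := algebraMap L _ i) (by rw [← map_pow, hi, map_neg, map_one]) fun _ d hd => ?_
    apply hc k.succ_ne_zero (i * Algebra.norm L d)
    have hnorm : Algebra.norm L (IntermediateField.AdjoinSimple.gen L x) = -c := by
      rw [← IntermediateField.adjoin.powerBasis_gen hint,
        Algebra.PowerBasis.norm_gen_eq_coeff_zero_minpoly]
      simp [IntermediateField.minpoly_gen, hx]
    rw [mul_pow, hi, ← map_pow, hd, hnorm]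
    ring

open Polynomial in
/-- Elements of `K[X]/(X ^ M - a)` are detected by evaluation at the `M`-th roots of `a`. -/
theorem AdjoinRoot.eq_zero_of_forall_aeval_eq_zero {K F : Type*} [Field K] [Field F] [IsAlgClosed F]
    [Algebra K F] {M : ℕ} {a : K} (hM : (M : K) ≠ 0) (ha : a ≠ 0) (p : K[X])
    (h : ∀ r : F, r ^ M = algebraMap K F a → aeval r p = 0) :
    AdjoinRoot.mk (X ^ M - C a) p = 0 := by
  rw [AdjoinRoot.mk_eq_zero]
  rcases eq_or_ne p 0 with rfl | hp
  · exact dvd_zero _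
  have hsep := separable_X_pow_sub_C a hM ha
  have hM0 : M ≠ 0 := by rintro rfl; simp at hM
  have hmonic : (X ^ M - C a).Monic := monic_X_pow_sub_C a hM0
  rw [← map_dvd_map' (algebraMap K F)]
  have hsplit := (IsAlgClosed.splits ((X ^ M - C a).map (algebraMap K F)))
  rw [hsplit.eq_prod_roots_of_monic (hmonic.map _),
    Multiset.prod_X_sub_C_dvd_iff_le_roots (Polynomial.map_ne_zero hp),
    Multiset.le_iff_subset (nodup_roots hsep.map)]
  intro r hr
  rw [mem_roots (hmonic.map _).ne_zero, IsRoot.def] at hr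
  rw [mem_roots (Polynomial.map_ne_zero hp), IsRoot.def, eval_map_algebraMap]
  apply h
  simpa [sub_eq_zero] using hr

/-- A finite separating family of primitive idempotents exhausts the minimal idempotents. -/
theorem isMinIdem_iff_of_primitive {A ι : Type*} [CommRing A] {P : ι → Prop} {e : ι → A}
    (hne : ∀ i, P i → e i ≠ 0) (hidem : ∀ i, P i → e i * e i = e i)
    (hsep : ∀ x, (∀ i, P i → x * e i = 0) → x = 0)
    (hprim : ∀ i, P i → ∀ f, f * f = f → f * e i = f → f = 0 ∨ f = e i) (x : A) :
    IsMinIdem x ↔ ∃ i, P i ∧ x = e i := by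
  constructor
  · rintro ⟨hx0, hxx, hmin⟩
    obtain ⟨i, hi, hxi⟩ : ∃ i, P i ∧ x * e i ≠ 0 := by
      by_contra! hcon
      exact hx0 (hsep x hcon)
    have hei := hidem i hi
    have hxe : x * e i = e i :=
      (hprim i hi (x * e i) (by rw [mul_mul_mul_comm, hxx, hei]) (by rw [mul_assoc, hei])).resolve_left
        hxi
    refine ⟨i, hi, ?_⟩
    by_contra hcon
    refine hmin ⟨e i, x - e i, hne i hi, sub_ne_zero.mpr hcon, hei, ?_, ?_, by ring⟩
    · linear_combination hxx - 2 * hxe + hei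
    · linear_combination hxe - hei
  · rintro ⟨i, hi, rfl⟩
    refine ⟨hne i hi, hidem i hi, ?_⟩
    rintro ⟨f₁, f₂, h1, h2, h11, -, h12, hsum⟩
    rcases hprim i hi f₁ h11 (by rw [hsum]; linear_combination h11 + h12) with h | h
    · exact h1 h
    · exact h2 (by linear_combination -hsum - h)

/-- The normalised sum of the powers of an `M`-th root of unity. -/
theorem inv_mul_geom_sum_eq_ite {F : Type*} [Field F] [DecidableEq F] {M : ℕ} (hM : (M : F) ≠ 0)
    {u : F} (hu : u ^ M = 1) :
    (M : F)⁻¹ * ∑ j ∈ Finset.range M, u ^ j = if u = 1 then 1 else 0 := by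
  split_ifs with h
  · simp [h, hM]
  · rw [geom_sum_eq h, hu]
    simp

theorem InK.pow_add_pow {K : Type*} [Field K] {x y : AlgebraicClosure K} (hadd : InK K (x + y))
    (hmul : InK K (x * y)) (j : ℕ) : InK K (x ^ j + y ^ j) := by
  change _ ∈ (algebraMap K (AlgebraicClosure K)).range at hadd hmul ⊢
  induction j using Nat.twoStepInduction with
  | zero => exact ⟨2, by rw [map_ofNat]; norm_num⟩
  | one => simpa using hadd
  | more j h0 h1 =>
    have h : x ^ (j + 2) + y ^ (j + 2) =
        (x + y) * (x ^ (j + 1) + y ^ (j + 1)) - x * y * (x ^ j + y ^ j) := by ring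
    rw [h]
    exact sub_mem (mul_mem hadd h1) (mul_mem hmul h0)

open Polynomial in
/-- If `x + y` and `x * y` lie in `K` but `x` does not, then `x` and `y` are conjugate. -/
theorem aeval_minpoly_eq_zero_of_add_mul {K : Type*} [Field K] {x y : AlgebraicClosure K}
    (hadd : InK K (x + y)) (hmul : InK K (x * y)) (hx : ¬InK K x) :
    aeval y (minpoly K x) = 0 := by
  obtain ⟨t, ht⟩ := hadd
  obtain ⟨d, hd⟩ := hmul
  have hint : IsIntegral K x := Algebra.IsIntegral.isIntegral x
  have hdeg : (C t * X - C d : K[X]).degree < 2 := by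
    compute_degree!
  have hq : (X ^ 2 - (C t * X - C d)).Monic := monic_X_pow_sub (by exact_mod_cast hdeg)
  have hdvd : minpoly K x ∣ X ^ 2 - (C t * X - C d) := minpoly.dvd K x (by
    simp only [map_sub, map_mul, map_pow, aeval_X, aeval_C, ht, hd]; ring)
  have heq := eq_of_monic_of_dvd_of_natDegree_le (minpoly.monic hint) hq hdvd (by
    rw [natDegree_sub_eq_left_of_natDegree_lt]
    · simpa using (minpoly.two_le_natDegree_iff hint).mpr hx
    · rw [natDegree_X_pow]
      by_cases h0 : (C t * X - C d : K[X]) = 0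
      · simp [h0]
      · exact (natDegree_lt_iff_degree_lt h0).mpr hdeg)
  rw [← heq]
  simp only [map_sub, map_mul, map_pow, aeval_X, aeval_C, ht, hd]
  ring

open Polynomial IntermediateField in
theorem irreducible_minpoly_comp_X_pow {K : Type*} [Field K] {c j : AlgebraicClosure K} (k : ℕ)
    (hj : j ∈ K⟮c⟯) (hj2 : j ^ 2 = -1) (hc : k ≠ 0 → ∀ d ∈ K⟮c⟯, d ^ 2 ≠ c) :
    Irreducible ((minpoly K c).comp (X ^ 2 ^ k)) := by
  have hint : IsIntegral K c := Algebra.IsIntegral.isIntegral c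
  refine irreducible_comp (minpoly.monic hint) (monic_X_pow _) (minpoly.irreducible hint)
    fun E _ _ x hx => ?_
  have hxint : IsIntegral K x := not_not.mp fun h => by
    apply minpoly.ne_zero hint
    rw [← hx, minpoly.eq_zero h]
  have hroot : aeval c (minpoly K (adjoin.powerBasis hxint).gen) = 0 := by
    rw [adjoin.powerBasis_gen, minpoly_gen, hx, minpoly.aeval]
  let τ : K⟮x⟯ →ₐ[K] AlgebraicClosure K := (adjoin.powerBasis hxint).lift c hroot
  have hτ : τ (AdjoinSimple.gen K x) = c := by
    rw [← adjoin.powerBasis_gen hxint]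
    exact (adjoin.powerBasis hxint).lift_gen c hroot
  obtain ⟨i, rfl⟩ : j ∈ τ.fieldRange := by
    refine (adjoin_simple_le_iff.mpr ?_ : K⟮c⟯ ≤ τ.fieldRange) hj
    exact ⟨_, hτ⟩
  have hrange (d : K⟮x⟯) : τ d ∈ K⟮c⟯ := by
    obtain ⟨p, rfl⟩ := (adjoin.powerBasis hxint).exists_eq_aeval' d
    rw [← aeval_algHom_apply, adjoin.powerBasis_gen, hτ]
    exact algebra_adjoin_le_adjoin K _ (aeval_mem_adjoin_singleton K c)
  rw [Polynomial.map_pow, map_X]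
  refine irreducible_X_pow_two_pow_sub_C k (i := i) ?_ ?_
  · apply τ.injective
    simpa using hj2
  · intro hk d hd
    exact hc hk (τ d) (hrange d) (by rw [← map_pow, hd, hτ])

theorem pow_two_pow_of_sq_eq {F : Type*} [Monoid F] {ε : ℕ → F} (hcomp : ∀ n, ε (n + 1) ^ 2 = ε n)
    (p k : ℕ) : ε (p + k) ^ 2 ^ k = ε p := by
  induction k with
  | zero => simp
  | succ k ih => rw [pow_succ', pow_mul, ← add_assoc, hcomp, ih]

/-- The twist `λ` satisfies `λ ^ 2 = 1`, `λ ^ 2 ^ (s - 1) = 1`, and `ε_{s+1}⁻¹` and `λ ε_{s+1}` have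
their sum in `K`. -/
theorem twist_properties {K : Type*} [Field K] (h2 : (2 : K) ≠ 0) {ε : ℕ → AlgebraicClosure K}
    (hprim : ∀ n : ℕ, IsPrimitiveRoot (ε n) (2 ^ n)) (hcomp : ∀ n : ℕ, ε (n + 1) ^ 2 = ε n)
    (hε2 : ¬InK K (ε 2)) {t m : ℕ} {lam : AlgebraicClosure K}
    (hcase : TypeC K ε ∨ ((TypeDc K ε m ∨ TypeEc K ε m) ∧ t + 1 ≤ m - 1))
    (hlam : (TypeEc K ε m ∧ t + 1 = m - 1 ∧ lam = -1) ∨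
      (¬(TypeEc K ε m ∧ t + 1 = m - 1) ∧ lam = 1)) :
    (lam = 1 ∨ lam = -1) ∧ lam ^ 2 ^ t = 1 ∧ InK K ((ε (t + 2))⁻¹ + lam * ε (t + 2)) := by
  have h0 (n) : ε n ≠ 0 := (hprim n).ne_zero (by positivity)
  have h2' : (2 : AlgebraicClosure K) ≠ 0 := by
    rw [← map_ofNat (algebraMap K (AlgebraicClosure K)) 2]
    exact (map_ne_zero _).mpr h2
  have hplusminus (hE : TypeEc K ε m) (hp : InK K (ε m + (ε m)⁻¹)) : False := by
    obtain ⟨-, hm, v, hv⟩ := hE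
    obtain ⟨u, hu⟩ := hp
    obtain ⟨k, rfl⟩ := Nat.exists_eq_add_of_le (show 2 ≤ m by lia)
    refine hε2 ⟨((u + v) / 2) ^ 2 ^ k, ?_⟩
    rw [← pow_two_pow_of_sq_eq hcomp 2 k, map_pow, map_div₀, map_add, hu, hv, map_ofNat]
    congr 1
    rw [div_eq_iff h2']
    ring
  have hpow {x y : AlgebraicClosure K} (hx : x ≠ 0) (hadd : InK K (x + y))
      (hmul : x * y = 1 ∨ x * y = -1) (j : ℕ) : InK K (x ^ j + y ^ j) :=
    hadd.pow_add_pow (hmul.elim (fun h => ⟨1, by simp [h]⟩) fun h => ⟨-1, by simp [h]⟩) j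
  rcases hlam with ⟨hE, hs, rfl⟩ | ⟨hE, rfl⟩
  · obtain rfl : m = t + 2 := by lia
    refine ⟨.inr rfl, ?_, ?_⟩
    · have : t ≠ 0 := by rintro rfl; exact absurd hE.2.1 (by norm_num)
      exact Even.neg_one_pow ((Nat.even_pow.mpr ⟨even_two, this⟩))
    · obtain ⟨v, hv⟩ := hE.2.2
      exact ⟨-v, by rw [map_neg, hv]; ring⟩
  · refine ⟨.inl rfl, one_pow _, ?_⟩
    rw [one_mul, add_comm]
    rcases hcase with hC | ⟨hD | hE', hs⟩
    · exact hC.2 _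
    · obtain ⟨k, rfl⟩ := Nat.exists_eq_add_of_le (show t + 2 ≤ m by lia)
      have := hpow (h0 _) hD.2.2.1 (.inl (mul_inv_cancel₀ (h0 _))) (2 ^ k)
      rwa [inv_pow, pow_two_pow_of_sq_eq hcomp] at this
    · obtain ⟨k, rfl⟩ := Nat.exists_eq_add_of_le (show t + 2 ≤ m by lia)
      have hk : k ≠ 0 := by rintro rfl; exact hE ⟨hE', by lia⟩
      have := hpow (h0 _) (by simpa [sub_eq_add_neg] using hE'.2.2)
        (.inr (by simp [h0])) (2 ^ k)
      rwa [(Nat.even_pow.mpr ⟨even_two, hk⟩).neg_pow, inv_pow, pow_two_pow_of_sq_eq hcomp] at this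

/-- Fourier inversion on the solutions of `v ^ 2 ^ (t + 1) = -1`, summed over the pair
`{z, λ z⁻¹}`. -/
theorem inv_mul_sum_eq_ite {F : Type*} [Field F] [DecidableEq F] (h2 : (2 : F) ≠ 0) {t : ℕ}
    {z v lam j : F} (hj : j ^ 2 = -1) (hz : z ^ 2 ^ t = j) (hlam : lam ^ 2 = 1)
    (hlamt : lam ^ 2 ^ t = 1) (hv : v ^ 2 ^ (t + 1) = -1) :
    (2 ^ (t + 1) : F)⁻¹ * ∑ l ∈ Finset.range (2 ^ (t + 1)),
      (z⁻¹ ^ l + (lam * z) ^ l) * v ^ l = if v = z ∨ v = lam * z⁻¹ then 1 else 0 := by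
  have hj0 : j ≠ 0 := by rintro rfl; norm_num at hj
  have hz0 : z ≠ 0 := by rintro rfl; exact hj0 (by rw [← hz]; simp)
  have hz2 : z ^ 2 ^ (t + 1) = -1 := by rw [pow_succ, pow_mul, hz, hj]
  have hM : ((2 ^ (t + 1) : ℕ) : F) ≠ 0 := by push_cast; exact pow_ne_zero _ h2
  have h1 := inv_mul_geom_sum_eq_ite hM (u := z⁻¹ * v) (by rw [mul_pow, inv_pow, hz2, hv]; norm_num)
  have h3 := inv_mul_geom_sum_eq_ite hM (u := lam * z * v) (by
    rw [mul_pow, mul_pow, hz2, hv, pow_succ, pow_mul, hlamt]; norm_num)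
  have e1 : z⁻¹ * v = 1 ↔ v = z := by rw [inv_mul_eq_one₀ hz0, eq_comm]
  have e3 : lam * z * v = 1 ↔ v = lam * z⁻¹ := by
    constructor
    · intro h
      field_simp
      linear_combination lam * h - v * z * hlam
    · rintro rfl
      field_simp
      exact hlam
  simp only [e1, e3] at h1 h3
  push_cast at h1 h3
  simp only [add_mul, ← mul_pow, Finset.sum_add_distrib, mul_add, h1, h3]
  have hne : z ≠ lam * z⁻¹ := fun h => by
    have := congrArg (· ^ 2 ^ t) h
    simp only [mul_pow, inv_pow, hz, hlamt, one_mul] at this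
    field_simp at this
    rw [hj] at this
    exact h2 (by linear_combination -this)
  by_cases hvz : v = z
  · subst hvz
    simp [hne]
  · simp [hvz]

theorem mem_adjoin_of_inv_add_mul {K : Type*} [Field K] (h2 : (2 : K) ≠ 0)
    {z lam j : AlgebraicClosure K} {t : ℕ} (hj : j ^ 2 = -1) (hz : z ^ 2 ^ t = j)
    (hlam : lam = 1 ∨ lam = -1) (hlamt : lam ^ 2 ^ t = 1) (hadd : InK K (z⁻¹ + lam * z)) :
    z ∈ IntermediateField.adjoin K {j} := by
  have hj0 : j ≠ 0 := by rintro rfl; norm_num at hj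
  have hz0 : z ≠ 0 := by rintro rfl; exact hj0 (by rw [← hz]; simp)
  have hlamK : InK K lam := hlam.elim (fun h => ⟨1, by simp [h]⟩) fun h => ⟨-1, by simp [h]⟩
  have hlam2 : lam ^ 2 = 1 := by rcases hlam with rfl | rfl <;> norm_num
  have hmul : z⁻¹ * (lam * z) = lam := by field_simp
  obtain ⟨q, hq⟩ := hadd.pow_add_pow (hmul.symm ▸ hlamK) (2 ^ t + 1)
  obtain ⟨p, hp⟩ := hadd
  obtain ⟨l, hl⟩ := hlamK
  have h2' : (2 : AlgebraicClosure K) ≠ 0 := by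
    rw [← map_ofNat (algebraMap K (AlgebraicClosure K)) 2]
    exact (map_ne_zero _).mpr h2
  have hinv : j⁻¹ = -j := by
    field_simp
    linear_combination hj
  rw [pow_succ, pow_succ, mul_pow, inv_pow, hz, hlamt, one_mul, hinv] at hq
  have hzeq : z = algebraMap K _ (l / 2) * (algebraMap K _ p - algebraMap K _ q * j) := by
    rw [hq, hp, map_div₀, hl, map_ofNat]
    field_simp
    linear_combination (-2 * z ^ 2) * hlam2 + (lam * (lam * z ^ 2 - 1)) * hj
  rw [hzeq]
  exact mul_mem (algebraMap_mem _ _) (sub_mem (algebraMap_mem _ _)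
    (mul_mem (algebraMap_mem _ _) (IntermediateField.mem_adjoin_simple_self K j)))

open Polynomial IntermediateField in
/-- The roots of `X ^ 2 ^ k - b z` and `X ^ 2 ^ k - b λ z⁻¹` are all conjugate over `K`. -/
theorem aeval_eq_zero_of_conj {K : Type*} [Field K] {z lam j : AlgebraicClosure K} {t k : ℕ} {b : K}
    (hb : b ≠ 0) (hjK : ¬InK K j) (hj : j ^ 2 = -1) (hz : z ^ 2 ^ t = j)
    (hlam : lam = 1 ∨ lam = -1) (hadd : InK K (z⁻¹ + lam * z))
    (hsq : k ≠ 0 → ∀ d ∈ K⟮algebraMap K _ b * z⟯, d ^ 2 ≠ algebraMap K _ b * z)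
    {p : K[X]} {r r' : AlgebraicClosure K}
    (hr : r ^ 2 ^ k = algebraMap K _ b * z ∨ r ^ 2 ^ k = algebraMap K _ b * (lam * z⁻¹))
    (hr' : r' ^ 2 ^ k = algebraMap K _ b * z ∨ r' ^ 2 ^ k = algebraMap K _ b * (lam * z⁻¹))
    (hp : aeval r p = 0) : aeval r' p = 0 := by
  have hj0 : j ≠ 0 := by rintro rfl; norm_num at hj
  have hz0 : z ≠ 0 := by rintro rfl; exact hj0 (by rw [← hz]; simp)
  have hb' : algebraMap K (AlgebraicClosure K) b ≠ 0 := (_root_.map_ne_zero _).mpr hb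
  obtain ⟨l, hl⟩ : InK K lam := hlam.elim (fun h => ⟨1, by simp [h]⟩) fun h => ⟨-1, by simp [h]⟩
  have hlam2 : lam ^ 2 = 1 := by rcases hlam with rfl | rfl <;> norm_num
  set c := algebraMap K (AlgebraicClosure K) b * z with hc
  have hj_eq : j = algebraMap K (AlgebraicClosure K) (b⁻¹ ^ 2 ^ t) * c ^ 2 ^ t := by
    rw [hc, map_pow, ← mul_pow, map_inv₀, inv_mul_cancel_left₀ hb', hz]
  have hcK : ¬InK K c := by
    rintro ⟨u, hu⟩
    exact hjK ⟨b⁻¹ ^ 2 ^ t * u ^ 2 ^ t, by rw [hj_eq, map_mul, map_pow _ u, hu]⟩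
  have hconj : aeval (algebraMap K (AlgebraicClosure K) b * (lam * z⁻¹)) (minpoly K c) = 0 := by
    refine aeval_minpoly_eq_zero_of_add_mul ?_ ?_ hcK
    · obtain ⟨u, hu⟩ := hadd
      refine ⟨b * l * u, ?_⟩
      rw [map_mul, map_mul, hl, hu, hc]
      linear_combination (algebraMap K _ b * z) * hlam2
    · refine ⟨b ^ 2 * l, ?_⟩
      rw [map_mul, map_pow, hl, hc]
      field_simp
  have hirr : Irreducible ((minpoly K c).comp (X ^ 2 ^ k)) := by
    refine irreducible_minpoly_comp_X_pow k (j := j) ?_ hj hsq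
    rw [hj_eq]
    exact mul_mem (IntermediateField.algebraMap_mem _ _) (pow_mem (mem_adjoin_simple_self K c) _)
  have hroot {x : AlgebraicClosure K}
      (hx : x ^ 2 ^ k = c ∨ x ^ 2 ^ k = algebraMap K _ b * (lam * z⁻¹)) :
      aeval x ((minpoly K c).comp (X ^ 2 ^ k)) = 0 := by
    rw [aeval_comp, map_pow, aeval_X]
    rcases hx with hx | hx <;> rw [hx]
    exacts [minpoly.aeval K c, hconj]
  have hmonic : ((minpoly K c).comp (X ^ 2 ^ k)).Monic :=
    (minpoly.monic (Algebra.IsIntegral.isIntegral c)).comp (monic_X_pow _) (by simp)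
  have hdvd := minpoly.dvd K r hp
  rw [← minpoly.eq_of_irreducible_of_monic hirr (hroot hr) hmonic] at hdvd
  exact aeval_eq_zero_of_dvd_aeval_eq_zero hdvd (hroot hr')

/-- Theorem 3, case 4): `ε₂ ∉ K`, `a ∈ -K*^{2^s}`, and either `K` is of type C
with `s ≥ 1`, or of type D or E with constant `m` and `1 ≤ s ≤ m - 1`; `λ = -1`
if `K` is of type E and `s = m - 1`, and `λ = 1` otherwise.  All the coefficients
below lie in `K` and the minimal idempotents of `A = K[X]/(X^{2^n} - a)` are
exactly
`e_i = (1/2^s)·Σ_j (ε_{s+1}^{-j}·ε_{s-1}^{-ij} + λ^j·ε_{s+1}^j·ε_{s-1}^{ij})·(b⁻¹·ḡ^{2^{n-s}})^j`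
for `0 ≤ i ≤ 2^{s-1} - 1`. -/
theorem stmt_18 (K : Type*) [Field K] (h2 : (2 : K) ≠ 0)
    (ε : ℕ → AlgebraicClosure K)
    (hprim : ∀ n : ℕ, IsPrimitiveRoot (ε n) (2 ^ n))
    (hcomp : ∀ n : ℕ, ε (n + 1) ^ 2 = ε n)
    (hε2 : ¬InK K (ε 2))
    (n : ℕ) (hn : 1 ≤ n) (a : K) (ha : a ≠ 0)
    -- `s = H_n(a)`:
    (s : ℕ) (hsn : s ≤ n) (hmem : MemKs K ε s a)
    (hmax : ∀ t : ℕ, t ≤ n → MemKs K ε t a → t ≤ s)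
    (m : ℕ)
    (hcase : (TypeC K ε ∧ 1 ≤ s) ∨
      ((TypeDc K ε m ∨ TypeEc K ε m) ∧ 1 ≤ s ∧ s ≤ m - 1))
    -- `a ∈ -K*^{2^s}`, written `a = -b^{2^s}`:
    (b : K) (hb : b ≠ 0) (hab : a = -b ^ 2 ^ s)
    (lam : AlgebraicClosure K)
    (hlam : (TypeEc K ε m ∧ s = m - 1 ∧ lam = -1) ∨
      (¬(TypeEc K ε m ∧ s = m - 1) ∧ lam = 1))
    -- `ḡ` is the image of `X` in `A = K[X]/(X^{2^n} - a)`: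
    (g : AdjoinRoot (Polynomial.X ^ 2 ^ n - Polynomial.C a))
    (hg : g = AdjoinRoot.root (Polynomial.X ^ 2 ^ n - Polynomial.C a))
    (φ : K →+* AdjoinRoot (Polynomial.X ^ 2 ^ n - Polynomial.C a))
    (hφ : φ = algebraMap K (AdjoinRoot (Polynomial.X ^ 2 ^ n - Polynomial.C a))) :
    ∃ w : ℕ → ℕ → K,
      (∀ i j : ℕ, algebraMap K (AlgebraicClosure K) (w i j) =
        (ε (s + 1))⁻¹ ^ j * (ε (s - 1))⁻¹ ^ (i * j) +
          lam ^ j * ε (s + 1) ^ j * ε (s - 1) ^ (i * j)) ∧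
      ∀ e : AdjoinRoot (Polynomial.X ^ 2 ^ n - Polynomial.C a),
        IsMinIdem e ↔
          ∃ i : ℕ, i < 2 ^ (s - 1) ∧
            e = φ (1 / 2 ^ s) *
              ∑ j ∈ Finset.range (2 ^ s), φ (w i j) * (φ b⁻¹ * g ^ 2 ^ (n - s)) ^ j := by
  classical
  obtain ⟨t, rfl⟩ : ∃ t, s = t + 1 := ⟨s - 1, by lia⟩
  obtain ⟨k, rfl⟩ := Nat.exists_eq_add_of_le hsn
  obtain ⟨hl, hlt, hadd⟩ := twist_properties h2 hprim hcomp hε2 (t := t) (by grind) hlam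
  subst hg hφ
  simp only [Nat.add_sub_cancel, Nat.add_sub_cancel_left, show t + 1 + 1 = t + 2 from rfl]
  have hl2 : lam ^ 2 = 1 := by rcases hl with rfl | rfl <;> norm_num
  have hlK : InK K lam := hl.elim (fun h => ⟨1, by simp [h]⟩) fun h => ⟨-1, by simp [h]⟩
  have h2F : (2 : AlgebraicClosure K) ≠ 0 := by
    rw [← map_ofNat (algebraMap K (AlgebraicClosure K)) 2]
    exact (map_ne_zero _).mpr h2
  have hbF : algebraMap K (AlgebraicClosure K) b ≠ 0 := (map_ne_zero _).mpr hb
  have hε (p) : ε p ≠ 0 := (hprim p).ne_zero (by positivity)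
  have hj : ε 2 ^ 2 = -1 := by
    rw [hcomp 1]
    exact (hprim 1).eq_neg_one_of_two_right
  have hη : ε (t + 2) ^ 2 ^ t = ε 2 := by
    rw [add_comm]
    exact pow_two_pow_of_sq_eq hcomp 2 t
  have hθ : ε t ^ 2 ^ t = 1 := (hprim t).pow_eq_one
  have hη4 : ε (t + 2) ^ 4 = ε t := pow_two_pow_of_sq_eq hcomp t 2
  let z (i : ℕ) : AlgebraicClosure K := ε (t + 2) * ε t ^ i
  have hz0 (i) : z i ≠ 0 := mul_ne_zero (hε _) (pow_ne_zero _ (hε _))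
  have hz (i) : z i ^ 2 ^ t = ε 2 := by
    rw [mul_pow, hη, ← pow_mul, mul_comm i, pow_mul, hθ, one_pow, mul_one]
  have hzadd (i j : ℕ) : InK K ((z i)⁻¹ ^ j + (lam * z i) ^ j) := by
    have h1 := hadd.pow_add_pow (by rwa [inv_mul_eq_div, mul_div_cancel_right₀ _ (hε _)])
      ((1 + 4 * i) * j)
    have h3 : z i = ε (t + 2) ^ (1 + 4 * i) := by rw [pow_add, pow_one, pow_mul, hη4]
    have h4 : lam ^ (1 + 4 * i) = lam := by
      rw [pow_add, pow_mul, show lam ^ 4 = (lam ^ 2) ^ 2 by ring, hl2]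
      simp
    rwa [pow_mul, pow_mul, inv_pow, mul_pow, ← h3, h4] at h1
  choose w hw using hzadd
  refine ⟨w, fun i j => ?_, ?_⟩
  · rw [hw, ← mul_pow, pow_mul, pow_mul, ← mul_pow, ← mul_pow, inv_pow (ε t), ← mul_inv, mul_assoc]
  have ha_eq : algebraMap K (AlgebraicClosure K) a = -algebraMap K (AlgebraicClosure K) b ^ 2 ^ (t + 1) := by simp [hab]
  have hMK : ((2 ^ (t + 1 + k) : ℕ) : K) ≠ 0 := by push_cast; exact pow_ne_zero _ h2
  have hN : 2 ^ (t + 1 + k) = 2 ^ k * 2 ^ (t + 1) := by ring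
  set A := AdjoinRoot (Polynomial.X ^ 2 ^ (t + 1 + k) - Polynomial.C a)
  have hroot {r : AlgebraicClosure K} (hr : r ^ 2 ^ (t + 1 + k) = algebraMap K (AlgebraicClosure K) a) :
      (Polynomial.X ^ 2 ^ (t + 1 + k) - Polynomial.C a).eval₂ (algebraMap K (AlgebraicClosure K)) r = 0 := by
    simp [hr]
  let ψ {r : AlgebraicClosure K} (hr : r ^ 2 ^ (t + 1 + k) = algebraMap K (AlgebraicClosure K) a) : A →+* (AlgebraicClosure K) :=
    AdjoinRoot.lift (algebraMap K (AlgebraicClosure K)) r (hroot hr)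
  have hzero (x : A) (hx : ∀ (r : AlgebraicClosure K) (hr : r ^ 2 ^ (t + 1 + k) = algebraMap K (AlgebraicClosure K) a), ψ hr x = 0) :
      x = 0 := by
    obtain ⟨p, rfl⟩ := AdjoinRoot.mk_surjective x
    exact AdjoinRoot.eq_zero_of_forall_aeval_eq_zero hMK ha p fun r hr => by
      have h := hx r hr
      rwa [AdjoinRoot.lift_mk] at h
  set e : ℕ → A := fun i => algebraMap K A (1 / 2 ^ (t + 1)) *
    ∑ j ∈ Finset.range (2 ^ (t + 1)), algebraMap K A (w i j) *
      (algebraMap K A b⁻¹ * AdjoinRoot.root _ ^ 2 ^ k) ^ j with he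
  let R (i : ℕ) (r : AlgebraicClosure K) : Prop :=
    r ^ 2 ^ k = algebraMap K (AlgebraicClosure K) b * z i ∨ r ^ 2 ^ k = algebraMap K (AlgebraicClosure K) b * (lam * (z i)⁻¹)
  have hv {r : AlgebraicClosure K} (hr : r ^ 2 ^ (t + 1 + k) = algebraMap K (AlgebraicClosure K) a) :
      ((algebraMap K (AlgebraicClosure K) b)⁻¹ * r ^ 2 ^ k) ^ 2 ^ (t + 1) = -1 := by
    rw [mul_pow, ← pow_mul, ← hN, hr, ha_eq, inv_pow, mul_neg,
      inv_mul_cancel₀ (pow_ne_zero _ hbF)]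
  have hval {r : AlgebraicClosure K} (hr : r ^ 2 ^ (t + 1 + k) = algebraMap K (AlgebraicClosure K) a) (i : ℕ) :
      ψ hr (e i) = if R i r then 1 else 0 := by
    have h := inv_mul_sum_eq_ite h2F hj (hz i) hl2 hlt (hv hr)
    have hψ (x : K) : ψ hr (algebraMap K A x) = algebraMap K (AlgebraicClosure K) x := AdjoinRoot.lift_of _
    have hψr : ψ hr (AdjoinRoot.root _) = r := AdjoinRoot.lift_root _
    simp only [he, map_mul, map_sum, map_pow, hψ, hψr, hw, map_ofNat, map_inv₀, one_div,
      inv_mul_eq_iff_eq_mul₀ hbF] at h ⊢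
    exact h
  have hex (i : ℕ) : ∃ r : AlgebraicClosure K, r ^ 2 ^ (t + 1 + k) = algebraMap K (AlgebraicClosure K) a ∧ R i r := by
    obtain ⟨r, hr⟩ := IsAlgClosed.exists_pow_nat_eq (algebraMap K (AlgebraicClosure K) b * z i)
      (n := 2 ^ k) (by positivity)
    refine ⟨r, ?_, .inl hr⟩
    rw [hN, pow_mul, hr, ha_eq, mul_pow, pow_succ, pow_mul (z i), hz, hj]
    ring
  have hconj (i : ℕ) {r r' : AlgebraicClosure K} (hr : r ^ 2 ^ (t + 1 + k) = algebraMap K (AlgebraicClosure K) a)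
      (hr' : r' ^ 2 ^ (t + 1 + k) = algebraMap K (AlgebraicClosure K) a) (hR : R i r) (hR' : R i r') (x : A)
      (hx : ψ hr x = 0) : ψ hr' x = 0 := by
    obtain ⟨p, rfl⟩ := AdjoinRoot.mk_surjective x
    rw [AdjoinRoot.lift_mk] at hx ⊢
    refine aeval_eq_zero_of_conj hb hε2 hj (hz i) hl ⟨w i 1, by simp [hw]⟩ ?_ hR hR' hx
    intro hk d hd hd2
    have hzi := mem_adjoin_of_inv_add_mul h2 hj (hz i) hl hlt ⟨w i 1, by simp [hw]⟩
    have hle : IntermediateField.adjoin K {algebraMap K (AlgebraicClosure K) b * z i} ≤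
        IntermediateField.adjoin K {ε 2} :=
      IntermediateField.adjoin_simple_le_iff.mpr
        (mul_mem (IntermediateField.algebraMap_mem _ _) hzi)
    have := hmax (t + 1 + 1) (by lia) ⟨d, hle hd, ?_, ?_⟩
    · lia
    · rintro rfl
      exact mul_ne_zero hbF (hz0 i) (by rw [← hd2]; simp)
    · rw [pow_succ' 2 (t + 1), pow_mul, hd2, ha_eq, mul_pow, pow_succ, pow_mul (z i), hz, hj]
      ring
  refine fun x => isMinIdem_iff_of_primitive (e := e) (fun i _ h => ?_) (fun i _ => ?_)
    (fun x hx => ?_) (fun i _ f hff hfe => ?_) x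
  · obtain ⟨r, hr, hR⟩ := hex i
    simpa [h, hR] using hval hr i
  · rw [← sub_eq_zero]
    refine hzero _ fun r hr => ?_
    rw [map_sub, map_mul, hval hr]
    split_ifs <;> simp
  · refine hzero x fun r hr => ?_
    obtain ⟨i, hi, hR⟩ : ∃ i, i < 2 ^ t ∧ R i r := by
      have hcover {v : AlgebraicClosure K} (hv : v ^ 2 ^ t = ε 2) : ∃ i < 2 ^ t, v = z i := by
        obtain ⟨i, hi, h⟩ := (hprim t).eq_pow_of_pow_eq_one (ξ := v / ε (t + 2))
          (by rw [div_pow, hv, hη, div_self (hε 2)])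
        exact ⟨i, hi, by simp only [z]; rw [h, mul_div_cancel₀ _ (hε _)]⟩
      set v := (algebraMap K (AlgebraicClosure K) b)⁻¹ * r ^ 2 ^ k with hv_def
      have hrv : r ^ 2 ^ k = algebraMap K _ b * v := (mul_inv_cancel_left₀ hbF _).symm
      have hv2 : (v ^ 2 ^ t) ^ 2 = ε 2 ^ 2 := by rw [← pow_mul, ← pow_succ, hv hr, hj]
      have hv0 : v ≠ 0 := by
        intro h0
        have := hv hr
        simp [← hv_def, h0] at this
      rcases sq_eq_sq_iff_eq_or_eq_neg.mp hv2 with h | h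
      · obtain ⟨i, hi, h⟩ := hcover h
        exact ⟨i, hi, .inl (by rw [hrv, h])⟩
      · obtain ⟨i, hi, h⟩ := hcover (v := lam * v⁻¹) (by
          rw [mul_pow, hlt, inv_pow, h, one_mul]
          exact inv_eq_of_mul_eq_one_right (by linear_combination -hj))
        refine ⟨i, hi, .inr ?_⟩
        rw [hrv, ← h, mul_inv, inv_inv, ← mul_assoc lam, mul_inv_cancel₀ (by grind), one_mul]
    have h := congrArg (ψ hr) (hx i hi)
    simpa [hval, hR] using h
  · obtain ⟨r, hr, hR⟩ := hex i
    have hsupp {r' : AlgebraicClosure K} (hr' : r' ^ 2 ^ (t + 1 + k) = algebraMap K (AlgebraicClosure K) a) (hR' : ¬R i r') :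
        ψ hr' f = 0 := by
      rw [← hfe, map_mul, hval hr', if_neg hR', mul_zero]
    have hψf : ψ hr f * ψ hr f = ψ hr f := by rw [← map_mul, hff]
    rcases IsIdempotentElem.iff_eq_zero_or_one.mp hψf with h | h
    · refine .inl (hzero f fun r' hr' => ?_)
      by_cases hR' : R i r'
      · exact hconj i hr hr' hR hR' f h
      · exact hsupp hr' hR'
    · refine .inr (sub_eq_zero.mp (hzero _ fun r' hr' => ?_))
      by_cases hR' : R i r'
      · exact hconj i hr hr' hR hR' _ (by rw [map_sub, h, hval hr, if_pos hR, sub_self])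
      · rw [map_sub, hsupp hr' hR', hval hr', if_neg hR', sub_self]
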